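/- Let H be a real Hilbert space and g : H → ℝ a convex Fréchet differentiable function whose gradient ∇g is L_g-Lipschitz continuous (L_g > 0). Then for every s > 0 and all x, y ∈ H: g(y − s∇g(y)) ≤ g(x) + ⟨∇g(y), y − x⟩ + ((L_g/2)s² − s)‖∇g(y)‖² − (1/(2L_g))‖∇g(y) − ∇g(x)‖². -/

import Mathlib

open Filter Topology
open scoped RealInnerProductSpace

section Gradient

variable {H : Type*} [NormedAddCommGroup H] [InnerProductSpace ℝ H] [CompleteSpace H]
  {g : H → ℝ} {g' : H → H}

/-- The derivative of a function along the affine line from `u` to `v`, in terms of its gradient. -/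
lemma HasGradientAt.hasDerivAt_lineMap {u v d : H} {t : ℝ}
    (h : HasGradientAt g d (AffineMap.lineMap u v t)) :
    HasDerivAt (fun r : ℝ => g (AffineMap.lineMap u v r)) ⟪d, v - u⟫ t := by
  exact h.hasFDerivAt.comp_hasDerivAt t AffineMap.hasDerivAt_lineMap

/-- A convex function lies above its tangent at any point of differentiability. -/
lemma ConvexOn.add_inner_gradient_le (hg : ConvexOn ℝ Set.univ g) {u d : H}
    (h : HasGradientAt g d u) (v : H) : g u + ⟪d, v - u⟫ ≤ g v := by
  have hconv : ConvexOn ℝ Set.univ (fun r : ℝ => g (AffineMap.lineMap u v r)) :=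
    hg.comp_affineMap (AffineMap.lineMap u v)
  have hderiv : HasDerivAt (fun r : ℝ => g (AffineMap.lineMap u v r)) ⟪d, v - u⟫ 0 :=
    HasGradientAt.hasDerivAt_lineMap (by simpa using h)
  have hslope := hconv.le_slope_of_hasDerivAt (Set.mem_univ 0) (Set.mem_univ 1) one_pos hderiv
  simp [slope_def_field] at hslope
  linarith

/-- The descent lemma: a function with Lipschitz gradient lies below its quadratic model. -/
lemma le_add_inner_gradient_add_sq {L : ℝ} (hg : ∀ u, HasGradientAt g (g' u) u)
    (hlip : ∀ u v, ‖g' u - g' v‖ ≤ L * ‖u - v‖) (u v : H) :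
    g v ≤ g u + ⟪g' u, v - u⟫ + L / 2 * ‖v - u‖ ^ 2 := by
  let φ : ℝ → ℝ := fun t =>
    g (AffineMap.lineMap u v t) - (t * ⟪g' u, v - u⟫ + t ^ 2 * (L / 2 * ‖v - u‖ ^ 2))
  have hφ (t : ℝ) : HasDerivAt φ (⟪g' (AffineMap.lineMap u v t), v - u⟫ -
      (⟪g' u, v - u⟫ + 2 * t * (L / 2 * ‖v - u‖ ^ 2))) t := by
    refine (hg _).hasDerivAt_lineMap.sub (HasDerivAt.add ?_ ?_)
    · simpa using (hasDerivAt_id t).mul_const ⟪g' u, v - u⟫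
    · simpa using (hasDerivAt_pow 2 t).mul_const (L / 2 * ‖v - u‖ ^ 2)
  have hanti : AntitoneOn φ (Set.Ici 0) := by
    refine antitoneOn_of_deriv_nonpos (convex_Ici 0)
      (fun t _ => (hφ t).continuousAt.continuousWithinAt)
      (fun t _ => (hφ t).differentiableAt.differentiableWithinAt) fun t ht => ?_
    have ht0 : 0 < t := by simpa using ht
    have hinner := real_inner_le_norm (g' (AffineMap.lineMap u v t) - g' u) (v - u)
    have hnorm : ‖g' (AffineMap.lineMap u v t) - g' u‖ ≤ L * (t * ‖v - u‖) := by
      refine (hlip _ _).trans_eq ?_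
      simp [AffineMap.lineMap_apply, norm_smul, abs_of_pos ht0]
    have hmul := mul_le_mul_of_nonneg_right hnorm (norm_nonneg (v - u))
    rw [inner_sub_left] at hinner
    rw [(hφ t).deriv]
    linarith
  have h01 := hanti (Set.mem_Ici.2 le_rfl) (Set.mem_Ici.2 zero_le_one) zero_le_one
  simp [φ] at h01
  linarith

/-- For a convex function with Lipschitz gradient, the tangent inequality improves by a quadratic
term in the difference of the gradients. -/
lemma ConvexOn.add_sq_gradient_sub_le {L : ℝ} (hL : 0 < L) (hconv : ConvexOn ℝ Set.univ g)
    (hg : ∀ u, HasGradientAt g (g' u) u)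
    (hlip : ∀ u v, ‖g' u - g' v‖ ≤ L * ‖u - v‖) (x y : H) :
    g y + ⟪g' y, x - y⟫ + 1 / (2 * L) * ‖g' y - g' x‖ ^ 2 ≤ g x := by
  have hupper := le_add_inner_gradient_add_sq hg hlip x (x + L⁻¹ • (g' y - g' x))
  have hlower := hconv.add_inner_gradient_le (hg y) (x + L⁻¹ • (g' y - g' x))
  rw [add_sub_cancel_left, inner_smul_right, norm_smul, Real.norm_of_nonneg (by positivity)]
    at hupper
  rw [add_sub_right_comm, inner_add_right, inner_smul_right] at hlower
  have hsq : ⟪g' y, g' y - g' x⟫ - ⟪g' x, g' y - g' x⟫ = ‖g' y - g' x‖ ^ 2 := by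
    rw [← inner_sub_left, real_inner_self_eq_norm_sq]
  have hcoef : L / 2 * (L⁻¹ * ‖g' y - g' x‖) ^ 2 =
      L⁻¹ * ‖g' y - g' x‖ ^ 2 - 1 / (2 * L) * ‖g' y - g' x‖ ^ 2 := by
    field_simp
    ring
  rw [hcoef, ← hsq] at hupper
  rw [← hsq]
  linarith

end Gradient

/-- Modified descent lemma: for a convex `g` with `L_g`-Lipschitz gradient and any `s > 0`,
`g(y − s∇g(y)) ≤ g(x) + ⟨∇g(y), y − x⟩ + (L_g s²/2 − s)‖∇g(y)‖² − (1/(2L_g))‖∇g(y) − ∇g(x)‖²`. -/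
theorem modified_descent_lemma
    {H : Type*} [NormedAddCommGroup H] [InnerProductSpace ℝ H] [CompleteSpace H]
    (g : H → ℝ) (g' : H → H) (Lg : ℝ) (hLg : 0 < Lg)
    (hg_convex : ConvexOn ℝ Set.univ g)
    (hg_diff : ∀ u : H, HasGradientAt g (g' u) u)
    (hg_lip : ∀ u v : H, ‖g' u - g' v‖ ≤ Lg * ‖u - v‖)
    (s : ℝ) (hs : 0 < s) (x y : H) :
    g (y - s • g' y) ≤ g x + ⟪g' y, y - x⟫ + (Lg / 2 * s ^ 2 - s) * ‖g' y‖ ^ 2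
      - (1 / (2 * Lg)) * ‖g' y - g' x‖ ^ 2 := by
  have hdescent := le_add_inner_gradient_add_sq hg_diff hg_lip y (y - s • g' y)
  have htangent := hg_convex.add_sq_gradient_sub_le hLg hg_diff hg_lip x y
  rw [sub_sub_cancel_left, inner_neg_right, inner_smul_right, real_inner_self_eq_norm_sq,
    norm_neg, norm_smul, mul_pow, Real.norm_of_nonneg hs.le] at hdescent
  rw [← neg_sub y x, inner_neg_right] at htangent
  linarith
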